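/- Let 𝓓 = (Ω, 𝓑) be a supersimple 2-(n,4,λ) design and ∞ ∈ Ω. Then: (1) the hole stabilizer π_∞(𝓓) is generated by a set A of elements (namely the elements [∞,a,b,∞] for distinct a, b ∈ Ω \ {∞}) each of which has support of size at most 6λ + 2; (2) if λ is even, then π_∞(𝓓) contains a nontrivial element of support at most 6(λ−1), i.e. μ(π_∞(𝓓)) ≤ 6(λ−1). -/

import Mathlib

open Equiv

variable {Ω : Type*} [DecidableEq Ω] [Fintype Ω]

/-- Two points of a 4-hypergraph are collinear if they are equal or some line contains both. -/
def HGCollinear (B : Finset (Finset Ω)) (x y : Ω) : Prop :=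
  x = y ∨ ∃ b ∈ B, x ∈ b ∧ y ∈ b

/-- A 4-hypergraph is pliable if any two lines sharing three pairwise distinct points are equal. -/
def HGPliable (B : Finset (Finset Ω)) : Prop :=
  ∀ b₁ ∈ B, ∀ b₂ ∈ B, ∀ p q r : Ω, p ≠ q → p ≠ r → q ≠ r →
    p ∈ b₁ → q ∈ b₁ → r ∈ b₁ → p ∈ b₂ → q ∈ b₂ → r ∈ b₂ → b₁ = b₂

/-- `g` is the elementary move `[x,y]`: it interchanges `x` and `y`, interchanges the
remaining two points of every line through `x` and `y`, and fixes everything else.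
For `x = y` it is the identity. -/
def IsElemMove (B : Finset (Finset Ω)) (x y : Ω) (g : Equiv.Perm Ω) : Prop :=
  (x = y ∧ g = 1) ∨
  (x ≠ y ∧ (∃ b ∈ B, x ∈ b ∧ y ∈ b) ∧ g x = y ∧ g y = x ∧
    ∀ z : Ω, z ≠ x → z ≠ y →
      ((∀ b ∈ B, ¬(x ∈ b ∧ y ∈ b ∧ z ∈ b)) → g z = z) ∧
      (∀ b ∈ B, x ∈ b → y ∈ b → z ∈ b →
        ∀ w ∈ b, w ≠ x → w ≠ y → w ≠ z → g z = w))

/-- `g` is the move sequence `[a₀,…,a_k]` recorded by the list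
(elementary moves applied left to right). -/
def IsMoveSeq (B : Finset (Finset Ω)) : List Ω → Equiv.Perm Ω → Prop
  | [], _ => False
  | [_], g => g = 1
  | a :: b :: l, g => ∃ e h : Equiv.Perm Ω,
      IsElemMove B a b e ∧ IsMoveSeq B (b :: l) h ∧ g = h * e

/-- The puzzle set `𝓛_𝓓` of all move sequences. -/
def puzzleSet (B : Finset (Finset Ω)) : Set (Equiv.Perm Ω) :=
  { g | ∃ l : List Ω, IsMoveSeq B l g }

/-- The hole stabiliser `π_x(𝓓)`: all closed move sequences starting and ending at `x`. -/
def holeStab (B : Finset (Finset Ω)) (x : Ω) : Set (Equiv.Perm Ω) :=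
  { g | ∃ l : List Ω, l.head? = some x ∧ l.getLast? = some x ∧ IsMoveSeq B l g }

/-- `(Ω, B)` is a 2-(n,4,λ) design: lines have four points and every pair of distinct
points lies in exactly `lam` lines. -/
def IsTwoDesign (B : Finset (Finset Ω)) (lam : ℕ) : Prop :=
  (∀ b ∈ B, b.card = 4) ∧
  ∀ p q : Ω, p ≠ q → (B.filter fun b => p ∈ b ∧ q ∈ b).card = lam

/-- Supersimple: any two distinct lines meet in at most two points. -/
def HGSupersimple (B : Finset (Finset Ω)) : Prop :=
  ∀ b₁ ∈ B, ∀ b₂ ∈ B, b₁ ≠ b₂ → (b₁ ∩ b₂).card ≤ 2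

/-- `x ∈ overline{a,c}`: `x` is `a`, `c`, or lies on a line containing both `a` and `c`. -/
def HGLineClosure (B : Finset (Finset Ω)) (a c x : Ω) : Prop :=
  x = a ∨ x = c ∨ ∃ b ∈ B, a ∈ b ∧ c ∈ b ∧ x ∈ b

/-- A system of imprimitivity for the hole stabiliser `π_x` acting on `Ω \ {x}`,
with `ℓ` blocks each of size `k`. -/
def IsHoleBlockSystem (B : Finset (Finset Ω)) (x : Ω) (P : Finset (Finset Ω))
    (k ℓ : ℕ) : Prop :=
  P.card = ℓ ∧ 1 < k ∧ 1 < ℓ ∧ (∀ Δ ∈ P, Δ.card = k) ∧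
  (∀ a : Ω, a ≠ x → ∃! Δ : Finset Ω, Δ ∈ P ∧ a ∈ Δ) ∧
  (∀ Δ ∈ P, x ∉ Δ) ∧
  (∀ g ∈ holeStab B x, ∀ Δ ∈ P, Δ.image (⇑g) ∈ P)

section MoveSequences

variable {α : Type*} {B : Finset (Finset α)} {lam : ℕ} {x y z w a b : α}
  {e f g h : Equiv.Perm α}

theorem IsElemMove.symm (he : IsElemMove B x y e) : IsElemMove B y x e := by
  rcases he with ⟨rfl, rfl⟩ | ⟨hxy, ⟨b, hb, hx, hy⟩, h₁, h₂, h₃⟩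
  · exact Or.inl ⟨rfl, rfl⟩
  · refine Or.inr ⟨hxy.symm, ⟨b, hb, hy, hx⟩, h₂, h₁, fun z hzy hzx => ?_⟩
    obtain ⟨h₄, h₅⟩ := h₃ z hzx hzy
    exact ⟨fun H => h₄ fun b hb ⟨h₁, h₂, h₃⟩ => H b hb ⟨h₂, h₁, h₃⟩,
      fun b hb hy hx hz w hw hwy hwx => h₅ b hb hx hy hz w hw hwx hwy⟩

theorem IsElemMove.eq_one (he : IsElemMove B x x e) : e = 1 := by
  rcases he with ⟨-, rfl⟩ | ⟨h, -⟩
  · rfl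
  · exact absurd rfl h

theorem IsElemMove.apply_left (he : IsElemMove B x y e) : e x = y := by
  rcases he with ⟨rfl, rfl⟩ | ⟨-, -, h, -⟩
  · rfl
  · exact h

theorem IsElemMove.apply_right (he : IsElemMove B x y e) : e y = x := he.symm.apply_left

theorem IsElemMove.apply_of_mem_line (he : IsElemMove B x y e) (hxy : x ≠ y) {b : Finset α}
    (hb : b ∈ B) (hx : x ∈ b) (hy : y ∈ b) (hz : z ∈ b) (hw : w ∈ b) (hzx : z ≠ x) (hzy : z ≠ y)
    (hwx : w ≠ x) (hwy : w ≠ y) (hwz : w ≠ z) : e z = w := by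
  rcases he with ⟨h, -⟩ | ⟨-, -, -, -, h⟩
  · exact absurd h hxy
  · exact (h z hzx hzy).2 b hb hx hy hz w hw hwx hwy hwz

theorem IsElemMove.apply_of_notMem_line (he : IsElemMove B x y e) (hzx : z ≠ x) (hzy : z ≠ y)
    (hz : ∀ b ∈ B, x ∈ b → y ∈ b → z ∉ b) : e z = z := by
  rcases he with ⟨-, rfl⟩ | ⟨-, -, -, -, h⟩
  · rfl
  · exact (h z hzx hzy).1 fun b hb ⟨h₁, h₂, h₃⟩ => hz b hb h₁ h₂ h₃

open Classical in
/-- The point to which the elementary move `[x,y]` sends `z`. -/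
noncomputable def elemMoveFun (B : Finset (Finset α)) (x y z : α) : α :=
  if z = x then y else if z = y then x else
    if h : ∃ w, w ≠ x ∧ w ≠ y ∧ w ≠ z ∧ ∃ b ∈ B, x ∈ b ∧ y ∈ b ∧ z ∈ b ∧ w ∈ b then h.choose
    else z

theorem isMoveSeq_closed_triple_iff :
    IsMoveSeq B [x, a, b, x] g ↔ ∃ s t u, IsElemMove B x a s ∧ IsElemMove B a b t ∧
      IsElemMove B b x u ∧ g = u * t * s := by
  simp only [IsMoveSeq]
  constructor
  · rintro ⟨s, _, hs, ⟨t, _, ht, ⟨u, _, hu, rfl, rfl⟩, rfl⟩, rfl⟩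
    exact ⟨s, t, u, hs, ht, hu, by rw [one_mul]⟩
  · rintro ⟨s, t, u, hs, ht, hu, rfl⟩
    exact ⟨s, u * t, hs, ⟨t, u, ht, ⟨u, 1, hu, rfl, by rw [one_mul]⟩, rfl⟩, rfl⟩

theorem IsMoveSeq.append {l l' : List α} (hl : IsMoveSeq B l g) (hlast : l.getLast? = some x)
    (hl' : IsMoveSeq B (x :: l') h) : IsMoveSeq B (l ++ l') (h * g) := by
  induction l generalizing g with
  | nil => exact hl.elim
  | cons a t ih =>
    cases t with
    | nil =>
      obtain rfl : g = 1 := hl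
      obtain rfl : a = x := by simpa using hlast
      simpa using hl'
    | cons b t =>
      obtain ⟨e, k, he, hk, rfl⟩ := hl
      exact ⟨e, h * k, he, ih hk (by simpa [List.getLast?_cons_cons] using hlast),
        (mul_assoc _ _ _).symm⟩

theorem one_mem_holeStab : (1 : Equiv.Perm α) ∈ holeStab B x := ⟨[x], rfl, rfl, rfl⟩

theorem mul_mem_holeStab (hg : g ∈ holeStab B x) (hh : h ∈ holeStab B x) :
    g * h ∈ holeStab B x := by
  obtain ⟨l, hhd, hlast, hl⟩ := hh
  obtain ⟨l', hhd', hlast', hl'⟩ := hg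
  cases l' with
  | nil => exact hl'.elim
  | cons c l' =>
    obtain rfl : c = x := by simpa using hhd'
    refine ⟨l ++ l', ?_, ?_, hl.append hlast hl'⟩
    · rw [List.head?_append, hhd]; rfl
    · rw [List.getLast?_append, hlast]
      cases l' with
      | nil => rfl
      | cons d l' =>
        rw [List.getLast?_cons_cons] at hlast'
        rw [hlast']; rfl

/-- The closed move sequences `[x,a,b,x]` with `x`, `a`, `b` distinct. -/
def triangleMoves (B : Finset (Finset α)) (x : α) : Set (Equiv.Perm α) :=
  { g | ∃ a b : α, a ≠ x ∧ b ≠ x ∧ a ≠ b ∧ IsMoveSeq B [x, a, b, x] g }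

theorem triangleMoves_subset_holeStab : triangleMoves B x ⊆ holeStab B x :=
  fun _ ⟨a, b, _, _, _, hg⟩ => ⟨[x, a, b, x], rfl, rfl, hg⟩

theorem closure_triangleMoves_subset_holeStab [Finite α] :
    (Subgroup.closure (triangleMoves B x) : Set (Equiv.Perm α)) ⊆ holeStab B x := by
  let S : Submonoid (Equiv.Perm α) :=
    { carrier := holeStab B x, one_mem' := one_mem_holeStab, mul_mem' := mul_mem_holeStab }
  rw [← Subgroup.coe_toSubmonoid, Subgroup.closure_toSubmonoid_of_finite]
  exact (Submonoid.closure_le (S := S)).2 triangleMoves_subset_holeStab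

theorem elemMoveFun_of_notMem_line (hzx : z ≠ x) (hzy : z ≠ y)
    (hz : ∀ b ∈ B, x ∈ b → y ∈ b → z ∉ b) : elemMoveFun B x y z = z := by
  rw [elemMoveFun, if_neg hzx, if_neg hzy, dif_neg]
  rintro ⟨w, -, -, -, b, hb, hx, hy, hz', -⟩
  exact hz b hb hx hy hz'

variable [DecidableEq α]

theorem HGSupersimple.pliable (hss : HGSupersimple B) : HGPliable B := by
  intro b₁ h₁ b₂ h₂ p q r hpq hpr hqr p₁ q₁ r₁ p₂ q₂ r₂
  by_contra hne
  have hsub : ({p, q, r} : Finset α) ⊆ b₁ ∩ b₂ := by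
    intro t ht
    simp only [Finset.mem_insert, Finset.mem_singleton] at ht
    rcases ht with rfl | rfl | rfl <;> simp [*]
  have hcard : ({p, q, r} : Finset α).card = 3 :=
    Finset.card_eq_three.2 ⟨p, q, r, hpq, hpr, hqr, rfl⟩
  have := Finset.card_le_card hsub
  have := hss b₁ h₁ b₂ h₂ hne
  omega

/-- Three distinct points of a four-point set leave exactly one further point. -/
theorem exists_fourth_of_card_eq_four {b : Finset α} (hb : b.card = 4) (hx : x ∈ b) (hy : y ∈ b)
    (hz : z ∈ b) (hxy : x ≠ y) (hzx : z ≠ x) (hzy : z ≠ y) :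
    ∃ w ∈ b, w ≠ x ∧ w ≠ y ∧ w ≠ z ∧ b = {x, y, z, w} := by
  have hcard : ({x, y, z} : Finset α).card = 3 :=
    Finset.card_eq_three.2 ⟨x, y, z, hxy, hzx.symm, hzy.symm, rfl⟩
  have hsub : ({x, y, z} : Finset α) ⊆ b := by
    intro t ht
    simp only [Finset.mem_insert, Finset.mem_singleton] at ht
    rcases ht with rfl | rfl | rfl <;> assumption
  obtain ⟨w, hwb, hw⟩ := Finset.exists_mem_notMem_of_card_lt_card
    (show ({x, y, z} : Finset α).card < b.card by omega)
  simp only [Finset.mem_insert, Finset.mem_singleton, not_or] at hw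
  refine ⟨w, hwb, hw.1, hw.2.1, hw.2.2, (Finset.eq_of_subset_of_card_le ?_ ?_).symm⟩
  · intro t ht
    simp only [Finset.mem_insert, Finset.mem_singleton] at ht
    rcases ht with rfl | rfl | rfl | rfl <;> assumption
  · rw [hb, show ({x, y, z, w} : Finset α) = insert w {x, y, z} by
      ext; simp only [Finset.mem_insert, Finset.mem_singleton]; tauto,
      Finset.card_insert_of_notMem (by simp [hw]), hcard]

theorem IsTwoDesign.exists_line (hdes : IsTwoDesign B lam) (hlam : 0 < lam) (hxy : x ≠ y) :
    ∃ b ∈ B, x ∈ b ∧ y ∈ b := by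
  have := hdes.2 x y hxy
  obtain ⟨b, hb⟩ := Finset.card_pos.1 (this ▸ hlam)
  exact ⟨b, (Finset.mem_filter.1 hb).1, (Finset.mem_filter.1 hb).2⟩

/-- The move sequence `[x,a,b,x]` for `x`, `a`, `b` on a common line fixes that line pointwise. -/
theorem closed_triple_apply_of_mem_line (hdes : IsTwoDesign B lam) {L : Finset α} (hL : L ∈ B)
    (hx : x ∈ L) (ha : a ∈ L) (hb : b ∈ L) (hax : a ≠ x) (hbx : b ≠ x) (hba : b ≠ a)
    (he : IsElemMove B x a e) (hf : IsElemMove B a b f) (hg : IsElemMove B b x g)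
    {z : α} (hz : z ∈ L) : (g * f * e) z = z := by
  obtain ⟨c, hc, hcx, hca, hcb, hLc⟩ :=
    exists_fourth_of_card_eq_four (hdes.1 L hL) hx ha hb hax.symm hbx hba
  have e₁ : e b = c := he.apply_of_mem_line hax.symm hL hx ha hb hc hbx hba hcx hca hcb
  have e₂ : e c = b := he.apply_of_mem_line hax.symm hL hx ha hc hb hcx hca hbx hba hcb.symm
  have f₁ : f x = c :=
    hf.apply_of_mem_line hba.symm hL ha hb hx hc hax.symm hbx.symm hca hcb hcx
  have f₂ : f c = x :=
    hf.apply_of_mem_line hba.symm hL ha hb hc hx hca hcb hax.symm hbx.symm hcx.symm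
  have g₁ : g a = c := hg.apply_of_mem_line hbx hL hb hx ha hc hba.symm hax hcb hcx hca
  have g₂ : g c = a := hg.apply_of_mem_line hbx hL hb hx hc ha hcb hcx hba.symm hax hca.symm
  rw [hLc] at hz
  simp only [Finset.mem_insert, Finset.mem_singleton] at hz
  simp only [Equiv.Perm.mul_apply]
  rcases hz with rfl | rfl | rfl | rfl
  · rw [he.apply_left, hf.apply_left, hg.apply_left]
  · rw [he.apply_right, f₁, g₂]
  · rw [e₁, f₂, hg.apply_right]
  · rw [e₂, hf.apply_right, g₁]

theorem elemMoveFun_of_mem_line (hdes : IsTwoDesign B lam) (hpl : HGPliable B) (hxy : x ≠ y)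
    {b : Finset α} (hb : b ∈ B) (hx : x ∈ b) (hy : y ∈ b) (hz : z ∈ b) (hw : w ∈ b) (hzx : z ≠ x)
    (hzy : z ≠ y) (hwx : w ≠ x) (hwy : w ≠ y) (hwz : w ≠ z) : elemMoveFun B x y z = w := by
  have H : ∃ w, w ≠ x ∧ w ≠ y ∧ w ≠ z ∧ ∃ b ∈ B, x ∈ b ∧ y ∈ b ∧ z ∈ b ∧ w ∈ b :=
    ⟨w, hwx, hwy, hwz, b, hb, hx, hy, hz, hw⟩
  rw [elemMoveFun, if_neg hzx, if_neg hzy, dif_pos H]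
  obtain ⟨hvx, hvy, hvz, b', hb', hx', hy', hz', hv'⟩ := H.choose_spec
  obtain rfl := hpl b hb b' hb' x y z hxy hzx.symm hzy.symm hx hy hz hx' hy' hz'
  obtain ⟨u, -, -, -, -, hbu⟩ := exists_fourth_of_card_eq_four (hdes.1 b hb) hx hy hz hxy hzx hzy
  generalize H.choose = v at *
  rw [hbu] at hw hv'
  simp only [Finset.mem_insert, Finset.mem_singleton] at hw hv'
  grind

variable [Fintype α]

theorem IsElemMove.unique (hdes : IsTwoDesign B lam) (he : IsElemMove B x y e)
    (hf : IsElemMove B x y f) : e = f := by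
  rcases eq_or_ne x y with rfl | hxy
  · rw [he.eq_one, hf.eq_one]
  ext z
  rcases eq_or_ne z x with rfl | hzx
  · rw [he.apply_left, hf.apply_left]
  rcases eq_or_ne z y with rfl | hzy
  · rw [he.apply_right, hf.apply_right]
  by_cases hz : ∀ b ∈ B, x ∈ b → y ∈ b → z ∉ b
  · rw [he.apply_of_notMem_line hzx hzy hz, hf.apply_of_notMem_line hzx hzy hz]
  · push Not at hz
    obtain ⟨b, hb, hx, hy, hz⟩ := hz
    obtain ⟨w, hw, hwx, hwy, hwz, -⟩ :=
      exists_fourth_of_card_eq_four (hdes.1 b hb) hx hy hz hxy hzx hzy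
    rw [he.apply_of_mem_line hxy hb hx hy hz hw hzx hzy hwx hwy hwz,
      hf.apply_of_mem_line hxy hb hx hy hz hw hzx hzy hwx hwy hwz]

theorem IsElemMove.mul_self (hdes : IsTwoDesign B lam) (he : IsElemMove B x y e) : e * e = 1 := by
  rcases eq_or_ne x y with rfl | hxy
  · rw [he.eq_one, one_mul]
  ext z
  rw [Equiv.Perm.mul_apply, Equiv.Perm.one_apply]
  rcases eq_or_ne z x with rfl | hzx
  · rw [he.apply_left, he.apply_right]
  rcases eq_or_ne z y with rfl | hzy
  · rw [he.apply_right, he.apply_left]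
  by_cases hz : ∀ b ∈ B, x ∈ b → y ∈ b → z ∉ b
  · simp only [he.apply_of_notMem_line hzx hzy hz]
  · push Not at hz
    obtain ⟨b, hb, hx, hy, hz⟩ := hz
    obtain ⟨w, hw, hwx, hwy, hwz, -⟩ :=
      exists_fourth_of_card_eq_four (hdes.1 b hb) hx hy hz hxy hzx hzy
    rw [he.apply_of_mem_line hxy hb hx hy hz hw hzx hzy hwx hwy hwz,
      he.apply_of_mem_line hxy hb hx hy hw hz hwx hwy hzx hzy hwz.symm]

theorem elemMoveFun_involutive (hdes : IsTwoDesign B lam) (hpl : HGPliable B) (hxy : x ≠ y) :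
    Function.Involutive (elemMoveFun B x y) := by
  intro z
  have hx' : elemMoveFun B x y x = y := if_pos rfl
  have hy' : elemMoveFun B x y y = x := by rw [elemMoveFun, if_neg hxy.symm, if_pos rfl]
  rcases eq_or_ne z x with rfl | hzx
  · rw [hx', hy']
  rcases eq_or_ne z y with rfl | hzy
  · rw [hy', hx']
  by_cases hz : ∀ b ∈ B, x ∈ b → y ∈ b → z ∉ b
  · simp only [elemMoveFun_of_notMem_line hzx hzy hz]
  · push Not at hz
    obtain ⟨b, hb, hx, hy, hz⟩ := hz
    obtain ⟨w, hw, hwx, hwy, hwz, -⟩ :=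
      exists_fourth_of_card_eq_four (hdes.1 b hb) hx hy hz hxy hzx hzy
    rw [elemMoveFun_of_mem_line hdes hpl hxy hb hx hy hz hw hzx hzy hwx hwy hwz,
      elemMoveFun_of_mem_line hdes hpl hxy hb hx hy hw hz hwx hwy hzx hzy hwz.symm]

theorem exists_isElemMove (hdes : IsTwoDesign B lam) (hlam : 0 < lam) (hss : HGSupersimple B)
    (x y : α) : ∃ e, IsElemMove B x y e := by
  rcases eq_or_ne x y with rfl | hxy
  · exact ⟨1, Or.inl ⟨rfl, rfl⟩⟩
  refine ⟨(elemMoveFun_involutive hdes hss.pliable hxy).toPerm, Or.inr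
    ⟨hxy, hdes.exists_line hlam hxy, if_pos rfl, ?_, fun z hzx hzy => ⟨fun hz => ?_,
      fun b hb hx hy hz w hw hwx hwy hwz => ?_⟩⟩⟩
  · exact (if_neg hxy.symm).trans (if_pos rfl)
  · exact elemMoveFun_of_notMem_line hzx hzy fun b hb h₁ h₂ h₃ => hz b hb ⟨h₁, h₂, h₃⟩
  · exact elemMoveFun_of_mem_line hdes hss.pliable hxy hb hx hy hz hw hzx hzy hwx hwy hwz

theorem IsElemMove.support_eq (hdes : IsTwoDesign B lam) (hxy : x ≠ y) (he : IsElemMove B x y e) :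
    e.support =
      {x, y} ∪ (B.filter fun b => x ∈ b ∧ y ∈ b).biUnion fun b => b \ {x, y} := by
  ext z
  simp only [Equiv.Perm.mem_support, Finset.mem_union, Finset.mem_insert, Finset.mem_singleton,
    Finset.mem_biUnion, Finset.mem_filter, Finset.mem_sdiff, not_or]
  rcases eq_or_ne z x with rfl | hzx
  · simp [he.apply_left, hxy.symm]
  rcases eq_or_ne z y with rfl | hzy
  · simp [he.apply_right, hxy]
  by_cases hz : ∀ b ∈ B, x ∈ b → y ∈ b → z ∉ b
  · simp only [he.apply_of_notMem_line hzx hzy hz, hzx, hzy]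
    simp only [ne_eq, not_true, or_self, false_or, false_iff, not_exists]
    exact fun b ⟨⟨hb, hx, hy⟩, hzb, _⟩ => hz b hb hx hy hzb
  · push Not at hz
    obtain ⟨b, hb, hx, hy, hz⟩ := hz
    obtain ⟨w, hw, hwx, hwy, hwz, -⟩ :=
      exists_fourth_of_card_eq_four (hdes.1 b hb) hx hy hz hxy hzx hzy
    rw [he.apply_of_mem_line hxy hb hx hy hz hw hzx hzy hwx hwy hwz]
    exact iff_of_true hwz (Or.inr ⟨b, ⟨hb, hx, hy⟩, hz, hzx, hzy⟩)

theorem IsElemMove.card_support (hdes : IsTwoDesign B lam) (hss : HGSupersimple B) (hxy : x ≠ y)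
    (he : IsElemMove B x y e) : e.support.card = 2 * lam + 2 := by
  have hpair : ({x, y} : Finset α).card = 2 := Finset.card_pair hxy
  have hline : ∀ b ∈ B.filter (fun b => x ∈ b ∧ y ∈ b), (b \ {x, y}).card = 2 := by
    intro b hb
    obtain ⟨hb, hx, hy⟩ := Finset.mem_filter.1 hb
    rw [Finset.card_sdiff_of_subset (by simp [Finset.insert_subset_iff, hx, hy]),
      hdes.1 b hb, hpair]
  rw [he.support_eq hdes hxy, Finset.card_union_of_disjoint, Finset.card_biUnion,
    Finset.sum_congr rfl hline, Finset.sum_const, hdes.2 x y hxy, hpair, smul_eq_mul]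
  · ring
  · intro b hb b' hb' hne
    obtain ⟨hb, hx, hy⟩ := Finset.mem_filter.1 hb
    obtain ⟨hb', hx', hy'⟩ := Finset.mem_filter.1 hb'
    refine Finset.disjoint_left.2 fun z hz hz' => hne ?_
    simp only [Finset.mem_sdiff, Finset.mem_insert, Finset.mem_singleton, not_or] at hz hz'
    exact hss.pliable b hb b' hb' x y z hxy (Ne.symm hz.2.1) (Ne.symm hz.2.2)
      hx hy hz.1 hx' hy' hz'.1
  · rw [Finset.disjoint_biUnion_right]
    exact fun b _ => Finset.disjoint_sdiff

theorem IsElemMove.line_subset_support (hdes : IsTwoDesign B lam) (hxy : x ≠ y)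
    (he : IsElemMove B x y e) {b : Finset α} (hb : b ∈ B) (hx : x ∈ b) (hy : y ∈ b) :
    b ⊆ e.support := by
  intro z hz
  rw [he.support_eq hdes hxy]
  simp only [Finset.mem_union, Finset.mem_insert, Finset.mem_singleton,
    Finset.mem_biUnion, Finset.mem_filter, Finset.mem_sdiff, not_or]
  by_cases hzx : z = x
  · exact Or.inl (Or.inl hzx)
  by_cases hzy : z = y
  · exact Or.inl (Or.inr hzy)
  exact Or.inr ⟨b, ⟨hb, hx, hy⟩, hz, hzx, hzy⟩

theorem IsElemMove.sign_of_even (hdes : IsTwoDesign B lam) (hss : HGSupersimple B)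
    (heven : Even lam) (hxy : x ≠ y) (he : IsElemMove B x y e) : Equiv.Perm.sign e = -1 := by
  have hcard : Fintype.card (Function.fixedPoints e) = Fintype.card α - (2 * lam + 2) := by
    rw [Equiv.Perm.card_fixedPoints, Equiv.Perm.sum_cycleType, he.card_support hdes hss hxy]
  have hle : 2 * lam + 2 ≤ Fintype.card α := he.card_support hdes hss hxy ▸ Finset.card_le_univ _
  rw [Equiv.Perm.sign_of_pow_two_eq_one (by rw [sq, he.mul_self hdes]), hcard,
    show (Fintype.card α - (Fintype.card α - (2 * lam + 2))) / 2 = lam + 1 by omega]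
  exact heven.add_one.neg_one_pow

theorem closed_triple_mem_closure (hdes : IsTwoDesign B lam) (he : IsElemMove B x a e)
    (hf : IsElemMove B a b f) (hg : IsElemMove B b x g) :
    g * f * e ∈ Subgroup.closure (triangleMoves B x) := by
  rcases eq_or_ne a x with rfl | hax
  · rw [he.eq_one, hf.unique hdes hg.symm, mul_one, hg.mul_self hdes]
    exact one_mem _
  rcases eq_or_ne b x with rfl | hbx
  · rw [hg.eq_one, hf.unique hdes he.symm, one_mul, he.mul_self hdes]
    exact one_mem _
  rcases eq_or_ne a b with rfl | hab
  · rw [hf.eq_one, hg.unique hdes he.symm, mul_one, he.mul_self hdes]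
    exact one_mem _
  · exact Subgroup.subset_closure
      ⟨a, b, hax, hbx, hab, isMoveSeq_closed_triple_iff.2 ⟨e, f, g, he, hf, hg, rfl⟩⟩

theorem IsMoveSeq.mul_mem_closure (hdes : IsTwoDesign B lam) (hlam : 0 < lam)
    (hss : HGSupersimple B) {l : List α} (hl : IsMoveSeq B (a :: l) g)
    (hlast : (a :: l).getLast? = some x) (he : IsElemMove B x a e) :
    g * e ∈ Subgroup.closure (triangleMoves B x) := by
  induction l generalizing a g e with
  | nil =>
    obtain rfl : g = 1 := hl
    obtain rfl : a = x := by simpa using hlast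
    rw [he.eq_one, mul_one]
    exact one_mem _
  | cons b t ih =>
    obtain ⟨f, k, hf, hk, rfl⟩ := hl
    obtain ⟨u, hu⟩ := exists_isElemMove hdes hlam hss x b
    have h₁ := ih hk (by simpa [List.getLast?_cons_cons] using hlast) hu
    have h₂ := closed_triple_mem_closure hdes he hf hu.symm
    have h₃ : k * f * e = (k * u) * (u * f * e) := by
      calc k * f * e = k * (u * u) * f * e := by rw [hu.mul_self hdes, mul_one]
        _ = _ := by group
    exact h₃ ▸ mul_mem h₁ h₂

theorem holeStab_eq_closure (hdes : IsTwoDesign B lam) (hlam : 0 < lam) (hss : HGSupersimple B) :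
    holeStab B x = Subgroup.closure (triangleMoves B x) := by
  refine Set.Subset.antisymm ?_ closure_triangleMoves_subset_holeStab
  rintro g ⟨l, hhd, hlast, hl⟩
  cases l with
  | nil => exact hl.elim
  | cons a l =>
    obtain rfl : a = x := by simpa using hhd
    simpa using hl.mul_mem_closure hdes hlam hss hlast (Or.inl ⟨rfl, rfl⟩)

theorem mem_support_of_mem_support_mul_mul {z : α} (hz : z ∈ (e * f * g).support) :
    z ∈ e.support ∪ f.support ∪ g.support := by
  have h₁ := Equiv.Perm.support_mul_le (e * f) g hz
  have h₂ := Equiv.Perm.support_mul_le e f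
  simp only [Finset.sup_eq_union, Finset.mem_union] at *
  exact h₁.imp_left fun h => Finset.mem_union.1 (h₂ h)

theorem card_support_le_of_mem_triangleMoves (hdes : IsTwoDesign B lam) (hss : HGSupersimple B)
    (hg : g ∈ triangleMoves B x) : g.support.card ≤ 6 * lam + 2 := by
  obtain ⟨a, b, hax, hbx, hab, hg⟩ := hg
  obtain ⟨s, t, u, hs, ht, hu, rfl⟩ := isMoveSeq_closed_triple_iff.1 hg
  have hsub : (u * t * s).support ⊆
      (u.support.erase x ∪ t.support.erase b) ∪ (s.support.erase x).erase a := by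
    intro z hz
    have hzx : z ≠ x := by
      rintro rfl
      simp [Equiv.Perm.mul_apply, hs.apply_left, ht.apply_left, hu.apply_left] at hz
    have := mem_support_of_mem_support_mul_mul hz
    have hbu : b ∈ u.support := by
      rw [Equiv.Perm.mem_support, hu.apply_left]; exact hbx.symm
    have hat : a ∈ t.support := by
      rw [Equiv.Perm.mem_support, ht.apply_left]; exact hab.symm
    simp only [Finset.mem_union, Finset.mem_erase] at this ⊢
    by_cases hza : z = a
    · subst hza; exact Or.inl (Or.inr ⟨hab, hat⟩)
    by_cases hzb : z = b
    · subst hzb; exact Or.inl (Or.inl ⟨hzx, hbu⟩)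
    tauto
  have hxu : x ∈ u.support := by
    rw [Equiv.Perm.mem_support, hu.apply_right]; exact hbx
  have hbt : b ∈ t.support := by
    rw [Equiv.Perm.mem_support, ht.apply_right]; exact hab
  have hxs : x ∈ s.support := by
    rw [Equiv.Perm.mem_support, hs.apply_left]; exact hax
  have has : a ∈ s.support.erase x := by
    rw [Finset.mem_erase, Equiv.Perm.mem_support, hs.apply_right]; exact ⟨hax, hax.symm⟩
  have h₁ := Finset.card_le_card hsub
  have h₂ := Finset.card_union_le (u.support.erase x ∪ t.support.erase b)
    ((s.support.erase x).erase a)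
  have h₃ := Finset.card_union_le (u.support.erase x) (t.support.erase b)
  rw [Finset.card_erase_of_mem hxu, Finset.card_erase_of_mem hbt, hu.card_support hdes hss hbx,
    ht.card_support hdes hss hab] at h₃
  rw [Finset.card_erase_of_mem has, Finset.card_erase_of_mem hxs,
    hs.card_support hdes hss hax.symm] at h₂
  omega

theorem exists_mem_holeStab_card_support_le (hdes : IsTwoDesign B lam) (hlam : 0 < lam)
    (hss : HGSupersimple B) (heven : Even lam) (hyx : y ≠ x) :
    ∃ g ∈ holeStab B x, g ≠ 1 ∧ g.support.card ≤ 6 * (lam - 1) := by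
  obtain ⟨L, hL, hx, hy⟩ := hdes.exists_line hlam hyx.symm
  obtain ⟨b, hb, hbxy⟩ := Finset.exists_mem_notMem_of_card_lt_card
    (show ({x, y} : Finset α).card < L.card by
      rw [Finset.card_pair hyx.symm, hdes.1 L hL]; decide)
  simp only [Finset.mem_insert, Finset.mem_singleton, not_or] at hbxy
  obtain ⟨hbx, hby⟩ : b ≠ x ∧ b ≠ y := hbxy
  obtain ⟨s, hs⟩ := exists_isElemMove hdes hlam hss x y
  obtain ⟨t, ht⟩ := exists_isElemMove hdes hlam hss y b
  obtain ⟨u, hu⟩ := exists_isElemMove hdes hlam hss b x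
  refine ⟨u * t * s, triangleMoves_subset_holeStab ⟨y, b, hyx, hbx, hby.symm,
    isMoveSeq_closed_triple_iff.2 ⟨s, t, u, hs, ht, hu, rfl⟩⟩, fun h => ?_, ?_⟩
  · have hsign := congrArg Equiv.Perm.sign h
    rw [map_mul, map_mul, hs.sign_of_even hdes hss heven hyx.symm,
      ht.sign_of_even hdes hss heven hby.symm, hu.sign_of_even hdes hss heven hbx, map_one] at hsign
    exact absurd hsign (by decide)
  · have hsub : (u * t * s).support ⊆ (u.support \ L ∪ t.support \ L) ∪ s.support \ L := by
      intro z hz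
      have hzL : z ∉ L := fun hzL => Equiv.Perm.mem_support.1 hz
        (closed_triple_apply_of_mem_line hdes hL hx hy hb hyx hbx hby hs ht hu hzL)
      have := mem_support_of_mem_support_mul_mul hz
      simp only [Finset.mem_union, Finset.mem_sdiff] at this ⊢
      tauto
    have h₁ := Finset.card_le_card hsub
    have h₂ := Finset.card_union_le (u.support \ L ∪ t.support \ L) (s.support \ L)
    have h₃ := Finset.card_union_le (u.support \ L) (t.support \ L)
    rw [Finset.card_sdiff_of_subset (hu.line_subset_support hdes hbx hL hb hx),
      Finset.card_sdiff_of_subset (ht.line_subset_support hdes hby.symm hL hy hb), hdes.1 L hL,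
      hu.card_support hdes hss hbx, ht.card_support hdes hss hby.symm] at h₃
    rw [Finset.card_sdiff_of_subset (hs.line_subset_support hdes hyx.symm hL hx hy), hdes.1 L hL,
      hs.card_support hdes hss hyx.symm] at h₂
    omega

end MoveSequences

/-- (Lemma 6.4) For a supersimple 2-(n,4,λ) design: (1) the hole
stabilizer `π_∞(𝓓)` is generated by the elements `[∞,a,b,∞]` (for distinct
`a, b ∈ Ω \ {∞}`), each of which has support of size at most `6λ + 2`; (2) if `λ` is
even then `π_∞(𝓓)` contains a nontrivial element of support at most `6(λ - 1)`. -/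
theorem stmt15 (B : Finset (Finset Ω)) (lam : ℕ) (hlam : 0 < lam)
    (hΩ : 2 ≤ Fintype.card Ω)
    (hdes : IsTwoDesign B lam) (hss : HGSupersimple B) (x : Ω) :
    (holeStab B x = ↑(Subgroup.closure { g : Equiv.Perm Ω |
        ∃ a b : Ω, a ≠ x ∧ b ≠ x ∧ a ≠ b ∧ IsMoveSeq B [x, a, b, x] g }) ∧
      ∀ g : Equiv.Perm Ω,
        (∃ a b : Ω, a ≠ x ∧ b ≠ x ∧ a ≠ b ∧ IsMoveSeq B [x, a, b, x] g) →
        g.support.card ≤ 6 * lam + 2) ∧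
    (lam % 2 = 0 → ∃ g ∈ holeStab B x, g ≠ 1 ∧ g.support.card ≤ 6 * (lam - 1)) := by
  refine ⟨⟨holeStab_eq_closure hdes hlam hss,
    fun g hg => card_support_le_of_mem_triangleMoves hdes hss hg⟩, fun heven => ?_⟩
  have : Nontrivial Ω := Fintype.one_lt_card_iff_nontrivial.1 hΩ
  obtain ⟨y, hyx⟩ := exists_ne x
  exact exists_mem_holeStab_card_support_le hdes hlam hss (Nat.even_iff.2 heven) hyx
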